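/- For any α > 1 + 1/√2 there exist constants 0 ≤ ν̃₁ < ν̃₂ ≤ 1 and d* > 0 such that for any constant d ≥ d* there exist c > 0 and n₀ such that for all n ≥ n₀ the following holds. Let k = α (log d / d) n, ν₁ = ν̃₁ k/n, ν₂ = ν̃₂ k/n. If Y, Y′ ∼ G(n,d/n) independently, then with probability at least 1 − exp(−cn): (a) the family ℱ(Y,Y′) = { F(·;Z) : Z on the path Y ↦ Y′ } on the domain 𝓑_n = {0,1}^n satisfies the overlap gap property with overlap R(x₁,x₂) = |⟨x₁,x₂⟩|/n and parameters (k, ν₁, ν₂); and (b) F(·;Y) and F(·;Y′) are ν₁-separated above k with respect to R. -/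

import Mathlib

open MeasureTheory ProbabilityTheory

/-- The Bernoulli measure on `ℝ` with mass `pr` at `1` and `1 - pr` at `0`. -/
noncomputable def bern (pr : ℝ) : Measure ℝ :=
  ENNReal.ofReal pr • Measure.dirac 1 + ENNReal.ofReal (1 - pr) • Measure.dirac 0

instance (pr : ℝ) : IsFiniteMeasure (bern pr) := by
  constructor
  simp only [bern, Measure.add_apply, Measure.smul_apply, smul_eq_mul,
    Measure.dirac_apply' _ MeasurableSet.univ]
  exact ENNReal.add_lt_top.2 ⟨ENNReal.mul_lt_top ENNReal.ofReal_lt_top (by simp),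
    ENNReal.mul_lt_top ENNReal.ofReal_lt_top (by simp)⟩

/-- The Erdős–Rényi measure: the law of `Y ∈ {0,1}^m` with i.i.d. `Bernoulli(pr)` entries
(`m` indexes the possible edges of a graph). -/
noncomputable def erMeasure (m : ℕ) (pr : ℝ) : Measure (Fin m → ℝ) :=
  Measure.pi fun _ => bern pr

/-- The `i`-th point `Z_i` on the path `Y ↦ Y'` through `{0,1}^m`:
the first `i` coordinates are those of `Y'`, the rest are those of `Y`. -/
def pathVec (m : ℕ) (x y : Fin m → ℝ) (i : ℕ) : Fin m → ℝ :=
  fun j => if (j : ℕ) < i then y j else x j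

/-- Given an enumeration `ord` of the `m = n(n-1)/2` vertex pairs and an edge-indicator
vector `Y ∈ {0,1}^m`, `AdjOf ord Y i j` says that `i` and `j` are adjacent in the graph
encoded by `Y`. -/
def AdjOf {n m : ℕ} (ord : Fin m ≃ {q : Fin n × Fin n // q.1 < q.2})
    (Y : Fin m → ℝ) (i j : Fin n) : Prop :=
  ∃ q : Fin m, Y q = 1 ∧ ((ord q : Fin n × Fin n) = (i, j) ∨ (ord q : Fin n × Fin n) = (j, i))

/-- The support `S(x) = {i : x_i = 1}` of `x ∈ {0,1}^n`. -/
def suppSet (n : ℕ) (x : Fin n → ℝ) : Set (Fin n) := {i | x i = 1}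

open Classical in
/-- `F(x; Y) = |S(x)| · 1{S(x) is an independent set of the graph Y}`. -/
noncomputable def Fmis {n m : ℕ} (ord : Fin m ≃ {q : Fin n × Fin n // q.1 < q.2})
    (Y : Fin m → ℝ) (x : Fin n → ℝ) : ℝ :=
  if ∀ i ∈ suppSet n x, ∀ j ∈ suppSet n x, ¬ AdjOf ord Y i j
  then ((suppSet n x).ncard : ℝ) else 0

/-- The Boolean cube `𝓑_n = {0,1}^n`. -/
def boolCube (n : ℕ) : Set (Fin n → ℝ) := {x | ∀ i, x i = 0 ∨ x i = 1}

/-- The normalized overlap `R(x, y) = |⟨x, y⟩| / n`. -/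
noncomputable def olap (n : ℕ) (x y : Fin n → ℝ) : ℝ := |∑ i, x i * y i| / n

/-- A family `F` of functions on a domain `Dom` satisfies the `(μ, ν₁, ν₂)`-overlap gap
property for the overlap `R`. -/
def HasOGP {X : Type*} (F : Set (X → ℝ)) (Dom : Set X) (R : X → X → ℝ)
    (μ ν₁ ν₂ : ℝ) : Prop :=
  ∀ f₁ ∈ F, ∀ f₂ ∈ F, ∀ x₁ ∈ Dom, ∀ x₂ ∈ Dom, μ ≤ f₁ x₁ → μ ≤ f₂ x₂ →
    R x₁ x₂ ∈ Set.Icc (0 : ℝ) ν₁ ∪ Set.Icc ν₂ 1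

/-- Two functions `f, g` on a domain `Dom` are `ν`-separated above `μ` with respect to the
overlap `R`. -/
def SeparatedAbove {X : Type*} (f g : X → ℝ) (Dom : Set X) (R : X → X → ℝ)
    (μ ν : ℝ) : Prop :=
  ∀ x ∈ Dom, ∀ y ∈ Dom, μ ≤ f x → μ ≤ g y → R x y ≤ ν

/-- The interpolated family `ℱ(Y, Y') = {F(·; Z) : Z on the path Y ↦ Y'}`. -/
noncomputable def misFamily {n m : ℕ} (ord : Fin m ≃ {q : Fin n × Fin n // q.1 < q.2})
    (Y Y' : Fin m → ℝ) : Set ((Fin n → ℝ) → ℝ) :=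
  {h | ∃ i : ℕ, i ≤ m ∧ h = fun x => Fmis ord (pathVec m Y Y' i) x}

open Classical in
/-- The rounding `V_f^η` of an output vector `v ∈ ℝ^n` to an independent set of the graph
`Y`: with `A = {i : v_i ≥ 1}`, `Ã = {i ∈ A : i has no neighbor in A}`,
`B = {i : v_i ∈ (1/2, 1)}`, return `Ã` if `|A \ Ã| + |B| ≤ η n`, else `∅`. -/
noncomputable def Vround {n m : ℕ} (ord : Fin m ≃ {q : Fin n × Fin n // q.1 < q.2})
    (η : ℝ) (Y : Fin m → ℝ) (v : Fin n → ℝ) : Set (Fin n) :=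
  let A : Set (Fin n) := {i | 1 ≤ v i}
  let Atil : Set (Fin n) := {i | i ∈ A ∧ ∀ j ∈ A, ¬ AdjOf ord Y i j}
  let B : Set (Fin n) := {i | 1 / 2 < v i ∧ v i < 1}
  if (((A \ Atil).ncard : ℝ) + (B.ncard : ℝ) ≤ η * n) then Atil else ∅

/-- `f` is a random polynomial of degree at most `D` in the `m` edge-indicator variables. -/
def IsRandPolyB (m n D : ℕ) {Ω : Type*} (f : Ω → (Fin m → ℝ) → Fin n → ℝ) : Prop :=
  ∀ ω, ∃ P : Fin n → MvPolynomial (Fin m) ℝ,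
    (∀ i, (P i).totalDegree ≤ D) ∧ ∀ Y i, f ω Y i = MvPolynomial.eval Y (P i)

/-- `f` `(k, δ, γ, η)`-optimizes the maximum independent set problem on `G(n, pr)`:
`E_{Y,ω} ‖f(Y,ω)‖₂² ≤ γ k`, and with probability at least `1 - δ`,
`|V_f^η(Y,ω)| ≥ k`. -/
noncomputable def OptimizesMIS (n m : ℕ) (ord : Fin m ≃ {q : Fin n × Fin n // q.1 < q.2})
    (pr : ℝ) {Ω : Type*} [MeasurableSpace Ω] (Pω : Measure Ω)
    (f : Ω → (Fin m → ℝ) → Fin n → ℝ) (k δ γ η : ℝ) : Prop :=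
  (∫ z, ∑ i, (f z.2 z.1 i) ^ 2 ∂((erMeasure m pr).prod Pω)) ≤ γ * k ∧
  ENNReal.ofReal (1 - δ) ≤
    ((erMeasure m pr).prod Pω)
      {z | k ≤ (((Vround ord η z.1 (f z.2 z.1)).ncard : ℕ) : ℝ)}

/-- There is no random degree-`D` polynomial that `(k, δ, γ, η)`-optimizes the maximum
independent set problem on `G(n, pr)`. -/
def NoRandPolyMIS (n m D : ℕ) (ord : Fin m ≃ {q : Fin n × Fin n // q.1 < q.2})
    (pr : ℝ) (k δ γ η : ℝ) : Prop :=
  ∀ (Ω : Type) [MeasurableSpace Ω] (Pω : Measure Ω), IsProbabilityMeasure Pω →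
    ∀ f : Ω → (Fin m → ℝ) → Fin n → ℝ,
      IsRandPolyB m n D f → ¬ OptimizesMIS n m ord pr Pω f k δ γ η



lemma bern_ne (p : ℝ) : bern p {1}ᶜ = ENNReal.ofReal (1 - p) := by
  simp [bern]

lemma bern_prob (p : ℝ) (h0 : 0 ≤ p) (h1 : p ≤ 1) : IsProbabilityMeasure (bern p) := by
  constructor
  simp only [bern, Measure.add_apply, Measure.smul_apply, smul_eq_mul, measure_univ, mul_one]
  rw [← ENNReal.ofReal_add h0 (by linarith)]
  simp

lemma er_prob (m : ℕ) (p : ℝ) (h0 : 0 ≤ p) (h1 : p ≤ 1) :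
    IsProbabilityMeasure (erMeasure m p) := by
  have := bern_prob p h0 h1
  unfold erMeasure
  infer_instance

lemma er_event (m : ℕ) (p : ℝ) (h0 : 0 ≤ p) (h1 : p ≤ 1) (E : Finset (Fin m)) :
    erMeasure m p {Y | ∀ q ∈ E, Y q ≠ 1} = ENNReal.ofReal (1 - p) ^ E.card := by
  have := bern_prob p h0 h1
  have : {Y : Fin m → ℝ | ∀ q ∈ E, Y q ≠ 1}
      = Set.pi Set.univ (fun q => if q ∈ E then ({1}ᶜ : Set ℝ) else Set.univ) := by
    ext Y
    simp only [Set.mem_ofPred_eq, Set.mem_pi, Set.mem_univ, true_implies]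
    refine forall_congr' fun q => ?_
    by_cases h : q ∈ E <;> simp [h]
  rw [this, erMeasure, Measure.pi_pi]
  have h2 : ∀ q : Fin m, (bern p) (if q ∈ E then ({1}ᶜ : Set ℝ) else Set.univ)
      = if q ∈ E then ENNReal.ofReal (1 - p) else 1 := by
    intro q
    by_cases h : q ∈ E
    · simp only [h, if_true, bern_ne]
    · simp only [h, if_false, measure_univ]
  simp only [h2]
  rw [Finset.prod_ite]
  simp

lemma er_rect (m : ℕ) (p : ℝ) (h0 : 0 ≤ p) (h1 : p ≤ 1) (E F : Finset (Fin m)) :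
    ((erMeasure m p).prod (erMeasure m p))
      {Z | (∀ q ∈ E, Z.1 q ≠ 1) ∧ (∀ q ∈ F, Z.2 q ≠ 1)}
      ≤ ENNReal.ofReal (Real.exp (-p * ((E.card : ℝ) + F.card))) := by
  have := er_prob m p h0 h1
  have h : {Z : (Fin m → ℝ) × (Fin m → ℝ) | (∀ q ∈ E, Z.1 q ≠ 1) ∧ (∀ q ∈ F, Z.2 q ≠ 1)}
      = {Y | ∀ q ∈ E, Y q ≠ 1} ×ˢ {Y | ∀ q ∈ F, Y q ≠ 1} := by
    ext Z; simp [Set.mem_prod]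
  rw [h, Measure.prod_prod, er_event m p h0 h1, er_event m p h0 h1, ← pow_add,
    ← ENNReal.ofReal_pow (by linarith)]
  apply ENNReal.ofReal_le_ofReal
  have : -p * ((E.card : ℝ) + F.card) = ((E.card + F.card : ℕ) : ℝ) * (-p) := by push_cast; ring
  rw [this, Real.exp_nat_mul]
  apply pow_le_pow_left₀ (by linarith)
  have := Real.add_one_le_exp (-p)
  linarith

/-- edges inside `S` -/
def Eset {n m : ℕ} (ord : Fin m ≃ {q : Fin n × Fin n // q.1 < q.2}) (S : Finset (Fin n)) :
    Finset (Fin m) :=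
  Finset.univ.filter fun q => (ord q : Fin n × Fin n).1 ∈ S ∧ (ord q : Fin n × Fin n).2 ∈ S

lemma Eset_inter {n m : ℕ} (ord : Fin m ≃ {q : Fin n × Fin n // q.1 < q.2})
    (S T : Finset (Fin n)) : Eset ord S ∩ Eset ord T = Eset ord (S ∩ T) := by
  ext q; simp [Eset]; tauto

lemma Eset_card {n m : ℕ} (ord : Fin m ≃ {q : Fin n × Fin n // q.1 < q.2})
    (S : Finset (Fin n)) : 2 * ((Eset ord S).card : ℝ) = (S.card : ℝ) ^ 2 - S.card := by
  have h1 : (Eset ord S).card = (S.offDiag.filter fun q => q.1 < q.2).card := by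
    apply Finset.card_bij (fun q _ => (ord q : Fin n × Fin n))
    · intro q hq
      have := (ord q).2
      simp only [Eset, Finset.mem_filter, Finset.mem_univ, true_and] at hq
      simp only [Finset.mem_filter, Finset.mem_offDiag]
      exact ⟨⟨hq.1, hq.2, this.ne⟩, this⟩
    · intro a _ b _ h
      exact ord.injective (Subtype.ext h)
    · intro b hb
      simp only [Finset.mem_filter, Finset.mem_offDiag] at hb
      refine ⟨ord.symm ⟨b, hb.2⟩, ?_, by simp⟩
      simp [Eset, hb.1.1, hb.1.2.1]
  have h2 : (S.offDiag.filter fun q => ¬ q.1 < q.2).card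
      = (S.offDiag.filter fun q => q.1 < q.2).card := by
    apply Finset.card_bij (fun q _ => q.swap)
    · intro q hq
      simp only [Finset.mem_filter, Finset.mem_offDiag, Prod.fst_swap, Prod.snd_swap] at hq ⊢
      refine ⟨⟨hq.1.2.1, hq.1.1, hq.1.2.2.symm⟩, ?_⟩
      exact lt_of_le_of_ne (not_lt.1 hq.2) hq.1.2.2.symm
    · intro a _ b _ h
      exact Prod.swap_injective h
    · intro b hb
      simp only [Finset.mem_filter, Finset.mem_offDiag] at hb
      refine ⟨b.swap, ?_, by simp⟩
      simp only [Finset.mem_filter, Finset.mem_offDiag, Prod.fst_swap, Prod.snd_swap]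
      exact ⟨⟨hb.1.2.1, hb.1.1, hb.1.2.2.symm⟩, not_lt.2 hb.2.le⟩
  have h3 := Finset.card_filter_add_card_filter_not (s := S.offDiag) (fun q => q.1 < q.2)
  rw [h2, ← h1, Finset.offDiag_card] at h3
  have h4 : (Eset ord S).card + (Eset ord S).card + S.card = S.card * S.card := by
    have : S.card ≤ S.card * S.card := Nat.le_mul_self _
    omega
  have h5 : ((Eset ord S).card : ℝ) + (Eset ord S).card + S.card = S.card * S.card := by
    exact_mod_cast h4
  linarith

/-- bad event for a pair -/
def Ev {n m : ℕ} (ord : Fin m ≃ {q : Fin n × Fin n // q.1 < q.2}) (i j : ℕ)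
    (P : Finset (Fin n) × Finset (Fin n)) : Set ((Fin m → ℝ) × (Fin m → ℝ)) :=
  {Z | (∀ q ∈ Eset ord P.1, pathVec m Z.1 Z.2 i q ≠ 1) ∧
       (∀ q ∈ Eset ord P.2, pathVec m Z.1 Z.2 j q ≠ 1)}

lemma Ev_bound {n m : ℕ} (ord : Fin m ≃ {q : Fin n × Fin n // q.1 < q.2}) (i j : ℕ)
    (P : Finset (Fin n) × Finset (Fin n)) (p : ℝ) (h0 : 0 ≤ p) (h1 : p ≤ 1) (K l : ℕ)
    (hP1 : P.1.card = K) (hP2 : P.2.card = K) (hl : (P.1 ∩ P.2).card = l) :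
    ((erMeasure m p).prod (erMeasure m p)) (Ev ord i j P)
      ≤ ENNReal.ofReal (Real.exp (-p * ((K : ℝ) ^ 2 - K - ((l : ℝ) ^ 2 - l) / 2))) := by
  set E1 := Eset ord P.1
  set E2 := Eset ord P.2
  set EA := (E1.filter fun q : Fin m => ¬ (q : ℕ) < i) ∪ (E2.filter fun q : Fin m => ¬ (q : ℕ) < j)
  set EB := (E1.filter fun q : Fin m => (q : ℕ) < i) ∪ (E2.filter fun q : Fin m => (q : ℕ) < j)
  have hsub : E1 ∪ E2 ⊆ EA ∪ EB := by
    intro q hq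
    simp only [EA, EB, Finset.mem_union, Finset.mem_filter] at hq ⊢
    tauto
  have hc : (E1 ∪ E2).card ≤ EA.card + EB.card :=
    (Finset.card_le_card hsub).trans (Finset.card_union_le _ _)
  have hu := Finset.card_union_add_card_inter E1 E2
  rw [Eset_inter] at hu
  have e1 := Eset_card ord P.1
  have e2 := Eset_card ord P.2
  have e3 := Eset_card ord (P.1 ∩ P.2)
  rw [hP1] at e1
  rw [hP2] at e2
  rw [hl] at e3
  refine le_trans (measure_mono ?_) ((er_rect m p h0 h1 EA EB).trans ?_)
  · rintro Z ⟨hZ1, hZ2⟩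
    constructor
    · intro q hq
      simp only [EA, Finset.mem_union, Finset.mem_filter] at hq
      rcases hq with ⟨hq, h⟩ | ⟨hq, h⟩
      · simpa [pathVec, h] using hZ1 q hq
      · simpa [pathVec, h] using hZ2 q hq
    · intro q hq
      simp only [EB, Finset.mem_union, Finset.mem_filter] at hq
      rcases hq with ⟨hq, h⟩ | ⟨hq, h⟩
      · simpa [pathVec, h] using hZ1 q hq
      · simpa [pathVec, h] using hZ2 q hq
  · apply ENNReal.ofReal_le_ofReal
    apply Real.exp_le_exp.2
    have hc' : ((E1 ∪ E2).card : ℝ) ≤ EA.card + EB.card := by exact_mod_cast hc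
    have hu' : ((E1 ∪ E2).card : ℝ) + (Eset ord (P.1 ∩ P.2)).card = E1.card + E2.card := by
      exact_mod_cast hu
    have : (K : ℝ) ^ 2 - K - ((l : ℝ) ^ 2 - l) / 2 ≤ EA.card + EB.card := by linarith
    have := mul_le_mul_of_nonneg_left this h0
    linarith

lemma Ev_bound_sep {n m : ℕ} (ord : Fin m ≃ {q : Fin n × Fin n // q.1 < q.2})
    (P : Finset (Fin n) × Finset (Fin n)) (p : ℝ) (h0 : 0 ≤ p) (h1 : p ≤ 1) (K : ℕ)
    (hP1 : P.1.card = K) (hP2 : P.2.card = K) :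
    ((erMeasure m p).prod (erMeasure m p)) (Ev ord 0 m P)
      ≤ ENNReal.ofReal (Real.exp (-p * ((K : ℝ) ^ 2 - K))) := by
  have e1 := Eset_card ord P.1
  have e2 := Eset_card ord P.2
  rw [hP1] at e1
  rw [hP2] at e2
  refine le_trans (measure_mono ?_) ((er_rect m p h0 h1 (Eset ord P.1) (Eset ord P.2)).trans ?_)
  · rintro Z ⟨hZ1, hZ2⟩
    constructor
    · intro q hq
      simpa [pathVec] using hZ1 q hq
    · intro q hq
      simpa [pathVec] using hZ2 q hq
  · have : ((Eset ord P.1).card : ℝ) + (Eset ord P.2).card = (K : ℝ) ^ 2 - K := by linarith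
    rw [this]

/-- pairs of sets of size `K` with intersection `l` -/
def prs (n K l : ℕ) : Finset (Finset (Fin n) × Finset (Fin n)) :=
  Finset.univ.filter fun P => P.1.card = K ∧ P.2.card = K ∧ (P.1 ∩ P.2).card = l

lemma prs_card (n K l : ℕ) : (prs n K l).card ≤ n.choose l * (n.choose (K - l)) ^ 2 := by
  let U : Finset (Fin n) := Finset.univ
  have : (prs n K l).card ≤ ((U.powersetCard l) ×ˢ
      ((U.powersetCard (K - l)) ×ˢ (U.powersetCard (K - l)))).card := by
    apply Finset.card_le_card_of_injOn (fun P => (P.1 ∩ P.2, P.1 \ P.2, P.2 \ P.1))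
    · intro P hP
      simp only [prs, Finset.coe_filter, Finset.mem_univ, true_and, Set.mem_ofPred_eq] at hP
      obtain ⟨h1, h2, h3⟩ := hP
      have a := Finset.card_sdiff_add_card_inter P.1 P.2
      have b := Finset.card_sdiff_add_card_inter P.2 P.1
      rw [Finset.inter_comm P.2] at b
      simp only [U, Finset.coe_product, Set.mem_prod, Finset.mem_coe, Finset.mem_powersetCard,
        Finset.subset_univ, true_and]
      exact ⟨h3, by omega, by omega⟩
    · intro P _ Q _ h
      simp only [Prod.mk.injEq] at h
      obtain ⟨h1, h2, h3⟩ := h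
      refine Prod.ext ?_ ?_
      · rw [← Finset.sdiff_union_inter P.1 P.2, h1, h2, Finset.sdiff_union_inter]
      · rw [← Finset.sdiff_union_inter P.2 P.1, Finset.inter_comm P.2, h1, h3, Finset.inter_comm,
          Finset.sdiff_union_inter]
  refine this.trans (le_of_eq ?_)
  simp [U, Finset.card_product, Finset.card_powersetCard, sq]

lemma choose_bd (n j : ℕ) (d : ℝ) (hd : 1 ≤ Real.log d) (hd0 : 0 < d) :
    (n.choose j : ℝ) ≤ Real.exp (n * (Real.log d / d) + j * Real.log d) := by
  set s := Real.log d / d with hs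
  have hs0 : 0 < s := by positivity
  have h1 : (n.choose j : ℝ) ≤ (n : ℝ) ^ j / (j.factorial : ℝ) := Nat.choose_le_pow_div j n
  have h2 : ((n : ℝ) * s) ^ j / (j.factorial : ℝ) ≤ Real.exp (n * s) :=
    Real.pow_div_factorial_le_exp _ (by positivity) _
  have h3 : (n : ℝ) ^ j / (j.factorial : ℝ)
      = (((n : ℝ) * s) ^ j / (j.factorial : ℝ)) * (s⁻¹) ^ j := by
    rw [mul_pow, inv_pow]; field_simp
  have h4 : s⁻¹ ≤ d := by
    rw [hs, inv_div]
    exact div_le_self hd0.le hd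
  have h5 : (s⁻¹) ^ j ≤ Real.exp (j * Real.log d) := by
    rw [Real.exp_nat_mul, Real.exp_log hd0]
    exact pow_le_pow_left₀ (by positivity) h4 _
  rw [Real.exp_add]
  rw [h3] at h1
  exact h1.trans (mul_le_mul h2 h5 (by positivity) (by positivity))

lemma prs_bd (n K l : ℕ) (hl : l ≤ K) (d : ℝ) (hd : 1 ≤ Real.log d) (hd0 : 0 < d) :
    ((prs n K l).card : ℝ) ≤
      Real.exp (3 * (n * (Real.log d / d)) + (2 * K - l) * Real.log d) := by
  have h : ((prs n K l).card : ℝ) ≤ n.choose l * (n.choose (K - l) : ℝ) ^ 2 := by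
    exact_mod_cast prs_card n K l
  have a := choose_bd n l d hd hd0
  have b := choose_bd n (K - l) d hd hd0
  refine h.trans ((mul_le_mul a (pow_le_pow_left₀ (by positivity) b 2) (by positivity)
    (by positivity)).trans (le_of_eq ?_))
  rw [sq, ← Real.exp_add, ← Real.exp_add, Nat.cast_sub hl]
  congr 1
  ring

lemma fam_bd {n m : ℕ} (ord : Fin m ≃ {q : Fin n × Fin n // q.1 < q.2}) (i j K l : ℕ)
    (μ : Measure ((Fin m → ℝ) × (Fin m → ℝ))) (a b B : ℝ)
    (ha : ((prs n K l).card : ℝ) ≤ Real.exp a)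
    (hb : ∀ P ∈ prs n K l, μ (Ev ord i j P) ≤ ENNReal.ofReal (Real.exp b)) (hB : a + b ≤ B) :
    μ (⋃ P ∈ prs n K l, Ev ord i j P) ≤ ENNReal.ofReal (Real.exp B) := by
  refine (measure_biUnion_finset_le _ _).trans ((Finset.sum_le_sum hb).trans ?_)
  rw [Finset.sum_const, nsmul_eq_mul, ← ENNReal.ofReal_natCast,
    ← ENNReal.ofReal_mul (by positivity)]
  apply ENNReal.ofReal_le_ofReal
  refine (mul_le_mul_of_nonneg_right ha (by positivity)).trans ?_
  rw [← Real.exp_add]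
  exact Real.exp_le_exp.2 hB

lemma choose_const (α : ℝ) (hα : 1 + 1 / Real.sqrt 2 < α) :
    ∃ ν₁ ν₂ δ : ℝ, 0 ≤ ν₁ ∧ ν₁ < ν₂ ∧ ν₂ ≤ 1 ∧ 0 < δ ∧
      (∀ β, ν₁ ≤ β → β ≤ ν₂ → (2 - β) * α - α ^ 2 * (1 - β ^ 2 / 2) ≤ -δ) ∧
      (∀ β, ν₁ ≤ β → (2 - β) * α - α ^ 2 ≤ -δ) := by
  set s := Real.sqrt 2 with hs
  have hs2 : s * s = 2 := Real.mul_self_sqrt (by norm_num)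
  have hs0 : 0 ≤ s := Real.sqrt_nonneg 2
  have hsl : 1.41 < s := by nlinarith
  have hsu : s < 1.42 := by nlinarith
  have hinv : 1 / s = s / 2 := by field_simp; nlinarith
  rw [hinv] at hα
  set g : ℝ → ℝ := fun β => (2 - β) * α - α ^ 2 * (1 - β ^ 2 / 2) with hg
  have hgc : Continuous g := by fun_prop
  have hg0 : g (2 - s) < 0 := by
    have : g (2 - s) = α * (s - α * (2 * s - 2)) := by simp only [hg]; ring_nf; nlinarith
    rw [this]
    apply mul_neg_of_pos_of_neg (by linarith)
    nlinarith
  have hev : ∀ᶠ β in nhds (2 - s), g β < g (2 - s) / 2 :=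
    hgc.continuousAt.eventually_lt continuousAt_const (by linarith)
  obtain ⟨ε, he, hball⟩ := Metric.eventually_nhds_iff.1 hev
  set e := min (ε / 2) 0.1 with hee
  have e1 : e ≤ ε / 2 := min_le_left _ _
  have e2 : e ≤ 0.1 := min_le_right _ _
  have e0 : 0 < e := lt_min (by linarith) (by norm_num)
  have d1 : min (-g (2 - s) / 2) 0.1 ≤ -g (2 - s) / 2 := min_le_left _ _
  have d2 : min (-g (2 - s) / 2) (0.1 : ℝ) ≤ 0.1 := min_le_right _ _
  refine ⟨2 - s - e, 2 - s + e, min (-g (2 - s) / 2) 0.1, by linarith, by linarith, by linarith,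
    lt_min (by linarith) (by norm_num), ?_, ?_⟩
  · intro β h1 h2
    have : g β < g (2 - s) / 2 := by
      apply hball
      rw [Real.dist_eq, abs_lt]
      constructor <;> linarith
    simp only [hg] at this ⊢ d1
    linarith
  · intro β h1
    have : (2 - β) * α - α ^ 2 = -(α * (α - (2 - β))) := by ring
    rw [this]
    have : 0.1 ≤ α * (α - (2 - β)) := by
      have h3 : 0.1 ≤ α - (2 - β) := by linarith
      nlinarith
    linarith

lemma poly_exp (A C : ℝ) (hA : 0 < A) :
    ∃ N : ℕ, ∀ n : ℕ, N ≤ n → 2 * ((n : ℝ) + 1) ^ 5 * Real.exp (-2 * A * n + C)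
      ≤ Real.exp (-A * n) := by
  have h := (Real.tendsto_pow_mul_exp_neg_atTop_nhds_zero 5).comp
    ((tendsto_natCast_atTop_atTop (R := ℝ)).atTop_add (tendsto_const_nhds (x := (1 : ℝ)))
      |>.const_mul_atTop hA)
  have hpos : 0 < A ^ 5 / (2 * Real.exp (C + A)) := by positivity
  obtain ⟨N, hN⟩ := Filter.eventually_atTop.1 (h.eventually (gt_mem_nhds hpos))
  refine ⟨N, fun n hn => ?_⟩
  have := hN n hn
  simp only [Function.comp] at this
  rw [lt_div_iff₀ (by positivity), mul_pow] at this
  have h5 : ((n : ℝ) + 1) ^ 5 * Real.exp (-(A * (n + 1))) * (2 * Real.exp (C + A)) < 1 := by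
    have hA5 : 0 < A ^ 5 := by positivity
    nlinarith
  have h6 : 2 * ((n : ℝ) + 1) ^ 5 * Real.exp (-2 * A * n + C)
      = (((n : ℝ) + 1) ^ 5 * Real.exp (-(A * (n + 1))) * (2 * Real.exp (C + A)))
        * Real.exp (-A * n) := by
    have : Real.exp (-2 * A * n + C)
      = Real.exp (-(A * (n + 1))) * Real.exp (C + A) * Real.exp (-A * n) := by
      rw [← Real.exp_add, ← Real.exp_add]; congr 1; ring
    rw [this]; ring
  rw [h6]
  have := Real.exp_pos (-A * n)
  nlinarith

open Classical in
/-- support as a finset -/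
noncomputable def sf {n : ℕ} (x : Fin n → ℝ) : Finset (Fin n) :=
  Finset.univ.filter fun i => x i = 1

lemma F_extract {n m : ℕ} (ord : Fin m ≃ {q : Fin n × Fin n // q.1 < q.2}) (Z : Fin m → ℝ)
    (x : Fin n → ℝ) (k : ℝ) (hk : 0 < k) (h : k ≤ Fmis ord Z x) :
    k ≤ ((sf x).card : ℝ) ∧ ∀ q ∈ Eset ord (sf x), Z q ≠ 1 := by
  unfold Fmis at h
  split_ifs at h with hI
  · have hs : suppSet n x = (sf x : Set (Fin n)) := by
      ext i; simp [suppSet, sf]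
    rw [hs, Set.ncard_coe_finset] at h
    refine ⟨h, fun q hq hZ => ?_⟩
    simp only [Eset, Finset.mem_filter, Finset.mem_univ, true_and, sf] at hq
    exact hI _ hq.1 _ hq.2 ⟨q, hZ, Or.inl rfl⟩
  · linarith

lemma olap_eq {n : ℕ} (x y : Fin n → ℝ) (hx : x ∈ boolCube n) (hy : y ∈ boolCube n) :
    olap n x y = ((sf x ∩ sf y).card : ℝ) / n := by
  have h : ∑ i, x i * y i = ((sf x ∩ sf y).card : ℝ) := by
    rw [Finset.card_eq_sum_ones, Nat.cast_sum]
    have : sf x ∩ sf y = Finset.univ.filter fun i => x i = 1 ∧ y i = 1 := by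
      ext i; simp [sf]
    rw [this, Finset.sum_filter]
    refine Finset.sum_congr rfl fun i _ => ?_
    rcases hx i with h1 | h1 <;> rcases hy i with h2 | h2 <;> simp [h1, h2]
  unfold olap
  rw [h, abs_of_nonneg (by positivity)]

lemma shrink {n K : ℕ} (S T : Finset (Fin n)) (hS : K ≤ S.card) (hT : K ≤ T.card) :
    ∃ S' T', S' ⊆ S ∧ T' ⊆ T ∧ S'.card = K ∧ T'.card = K ∧
      (S' ∩ T').card = min K (S ∩ T).card := by
  rcases le_total (S ∩ T).card K with h | h
  · obtain ⟨S', a1, a2, a3⟩ := Finset.exists_subsuperset_card_eq Finset.inter_subset_left h hS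
    obtain ⟨T', b1, b2, b3⟩ := Finset.exists_subsuperset_card_eq Finset.inter_subset_right h hT
    refine ⟨S', T', a2, b2, a3, b3, ?_⟩
    rw [min_eq_right h]
    congr 1
    exact Finset.Subset.antisymm (Finset.inter_subset_inter a2 b2) (Finset.subset_inter a1 b1)
  · obtain ⟨U, hU, hc⟩ := Finset.exists_subset_card_eq h
    refine ⟨U, U, hU.trans Finset.inter_subset_left, hU.trans Finset.inter_subset_right, hc, hc, ?_⟩
    rw [min_eq_left h, Finset.inter_self, hc]

lemma Eset_mono {n m : ℕ} (ord : Fin m ≃ {q : Fin n × Fin n // q.1 < q.2})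
    {S T : Finset (Fin n)} (h : S ⊆ T) : Eset ord S ⊆ Eset ord T := by
  intro q hq
  simp only [Eset, Finset.mem_filter, Finset.mem_univ, true_and] at hq ⊢
  exact ⟨h hq.1, h hq.2⟩

lemma to_Ev {n m : ℕ} (ord : Fin m ≃ {q : Fin n × Fin n // q.1 < q.2}) (i j : ℕ)
    (Z : (Fin m → ℝ) × (Fin m → ℝ)) (x y : Fin n → ℝ) (k : ℝ) (hk : 0 < k)
    (hx : k ≤ Fmis ord (pathVec m Z.1 Z.2 i) x) (hy : k ≤ Fmis ord (pathVec m Z.1 Z.2 j) y) :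
    ∃ P ∈ prs n ⌈k⌉₊ (min ⌈k⌉₊ (sf x ∩ sf y).card), Z ∈ Ev ord i j P := by
  obtain ⟨a1, a2⟩ := F_extract ord _ x k hk hx
  obtain ⟨b1, b2⟩ := F_extract ord _ y k hk hy
  obtain ⟨S, T, hS, hT, cS, cT, c⟩ := shrink (sf x) (sf y) (Nat.ceil_le.2 a1) (Nat.ceil_le.2 b1)
  refine ⟨(S, T), by simp [prs, cS, cT, c], ?_, ?_⟩
  · exact fun q hq => a2 q (Eset_mono ord hS hq)
  · exact fun q hq => b2 q (Eset_mono ord hT hq)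

lemma exponent (α d n K l δ k Lg p L : ℝ) (hd : 0 < d) (hn : 0 < n) (hα : 0 < α)
    (hLg : 0 < Lg) (hδ : 5 ≤ δ * Lg) (hL : L = Lg / d) (hk : k = α * L * n) (hp : p = d / n)
    (hK : k ≤ K) (hK1 : 1 ≤ K) (hK2 : K ≤ k + 1) (hl : 0 ≤ l) (w : ℝ) (hw : 0 ≤ w)
    (hG : (2 - l / k) * α - α ^ 2 * (1 - w * (l / k) ^ 2) ≤ -δ) :
    (3 * (n * L) + (2 * K - l) * Lg) + (-p * (K ^ 2 - K - w * (l ^ 2 - l)))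
      ≤ -2 * L * n + (2 + α) * Lg := by
  have hL0 : 0 < L := by rw [hL]; positivity
  have hk0 : 0 < k := by rw [hk]; positivity
  have hp0 : 0 < p := by rw [hp]; positivity
  obtain ⟨β, hβ⟩ : ∃ β, β = l / k := ⟨_, rfl⟩
  have hlβ : l = β * k := by rw [hβ]; field_simp
  rw [← hβ] at hG
  have hpk : p * k = α * Lg := by rw [hp, hk, hL]; field_simp
  have hpk2 : p * k ^ 2 = α ^ 2 * (L * n * Lg) := by
    rw [sq, ← mul_assoc, hpk, hk]; ring
  have h1 : k ^ 2 - k ≤ K ^ 2 - K := by nlinarith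
  have h2 : k ^ 2 - k - w * l ^ 2 ≤ K ^ 2 - K - w * (l ^ 2 - l) := by nlinarith
  have h3 := mul_le_mul_of_nonneg_left h2 hp0.le
  have h4 : p * (k ^ 2 - k - w * l ^ 2) = α ^ 2 * (L * n * Lg) * (1 - w * β ^ 2) - α * Lg := by
    rw [← hpk2, ← hpk, hlβ]; ring
  have h5 : (2 * K - l) * Lg ≤ (2 - β) * α * (L * n * Lg) + 2 * Lg := by
    have : (2 - β) * α * (L * n * Lg) = (2 * k - l) * Lg := by rw [hlβ, hk]; ring
    rw [this]; nlinarith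
  have h6 := mul_le_mul_of_nonneg_left hG (show 0 ≤ L * n * Lg by positivity)
  have h7 := mul_le_mul_of_nonneg_left hδ (show 0 ≤ L * n by positivity)
  nlinarith

/-- For any `α > 1 + 1/√2` there are `0 ≤ ν̃₁ < ν̃₂ ≤ 1` and `d* > 0`
such that for any `d ≥ d*` there are `c > 0` and `n₀` such that for all `n ≥ n₀`, with
`k = α (log d / d) n`, `ν₁ = ν̃₁ k/n`, `ν₂ = ν̃₂ k/n`, and `Y, Y' ∼ G(n, d/n)` independent:
with probability at least `1 - exp(-c n)`, the family `ℱ(Y, Y')` on `𝓑_n = {0,1}^n`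
satisfies the `(k, ν₁, ν₂)`-OGP with overlap `R(x,y) = |⟨x,y⟩|/n`, and `F(·;Y)`, `F(·;Y')`
are `ν₁`-separated above `k`. -/
theorem stmt_15 (α : ℝ) (hα : 1 + 1 / Real.sqrt 2 < α) :
    ∃ ν₁t ν₂t : ℝ, 0 ≤ ν₁t ∧ ν₁t < ν₂t ∧ ν₂t ≤ 1 ∧
      ∃ dstar > (0 : ℝ), ∀ d : ℝ, dstar ≤ d →
        ∃ c > (0 : ℝ), ∃ n₀ : ℕ, ∀ n : ℕ, n₀ ≤ n →
          ∀ m : ℕ, m = n * (n - 1) / 2 →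
          ∀ ord : Fin m ≃ {q : Fin n × Fin n // q.1 < q.2},
            ENNReal.ofReal (1 - Real.exp (-c * n)) ≤
              ((erMeasure m (d / n)).prod (erMeasure m (d / n)))
                {YY' | HasOGP (misFamily ord YY'.1 YY'.2) (boolCube n) (olap n)
                         (α * (Real.log d / d) * n)
                         (ν₁t * (α * (Real.log d / d) * n / n))
                         (ν₂t * (α * (Real.log d / d) * n / n)) ∧
                       SeparatedAbove (Fmis ord YY'.1) (Fmis ord YY'.2)
                         (boolCube n) (olap n)
                         (α * (Real.log d / d) * n)
                         (ν₁t * (α * (Real.log d / d) * n / n))} := by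
  obtain ⟨ν₁, ν₂, δ, hν0, hν12, hν1, hδ, hG1, hG2⟩ := choose_const α hα
  have hα0 : 0 < α := by
    have : (0 : ℝ) ≤ 1 / Real.sqrt 2 := by positivity
    linarith
  refine ⟨ν₁, ν₂, hν0, hν12, hν1, Real.exp (max 1 (5 / δ)), Real.exp_pos _, fun d hd => ?_⟩
  have hd0 : 0 < d := (Real.exp_pos _).trans_le hd
  have hLg := (Real.le_log_iff_exp_le hd0).2 hd
  have hLg1 : 1 ≤ Real.log d := (le_max_left _ _).trans hLg
  have hLgδ : 5 ≤ δ * Real.log d := by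
    have := (le_max_right _ _).trans hLg
    rw [div_le_iff₀ hδ] at this
    linarith
  obtain ⟨L, hL⟩ : ∃ L, L = Real.log d / d := ⟨_, rfl⟩
  have hL0 : 0 < L := by rw [hL]; positivity
  obtain ⟨N, hN⟩ := poly_exp L ((2 + α) * Real.log d) hL0
  refine ⟨L, hL0, max N (⌈d⌉₊ + 1), fun n hn m hm ord => ?_⟩
  have hnN := (le_max_left _ _).trans hn
  have hnd : d ≤ n := by
    have h1 : ⌈d⌉₊ ≤ n := by have := (le_max_right _ _).trans hn; omega
    exact Nat.ceil_le.1 h1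
  have hn0 : (0 : ℝ) < n := hd0.trans_le hnd
  rw [← hL]
  obtain ⟨p, hp⟩ : ∃ p, p = d / (n : ℝ) := ⟨_, rfl⟩
  have hp0 : 0 ≤ p := by rw [hp]; positivity
  have hp1 : p ≤ 1 := by rw [hp]; exact (div_le_one hn0).2 hnd
  rw [← hp]
  obtain ⟨k, hk⟩ : ∃ k, k = α * L * n := ⟨_, rfl⟩
  have hk0 : 0 < k := by rw [hk]; positivity
  rw [← hk]
  have := er_prob m p hp0 hp1
  set μ := (erMeasure m p).prod (erMeasure m p) with hμ
  set K := ⌈k⌉₊ with hKd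
  have hK : k ≤ K := Nat.le_ceil k
  have hK2 : (K : ℝ) ≤ k + 1 := (Nat.ceil_lt_add_one hk0.le).le
  have hK1 : (1 : ℝ) ≤ K := by exact_mod_cast Nat.ceil_pos.2 hk0
  set B := -2 * L * n + (2 + α) * Real.log d with hB
  classical
  set T1 : Finset (ℕ × ℕ × ℕ) := Finset.range (m + 1) ×ˢ (Finset.range (m + 1) ×ˢ
    ((Finset.range (n + 1)).filter fun l : ℕ => l ≤ K ∧ ν₁ * k < l ∧ (l : ℝ) < ν₂ * k)) with hT1
  set T2 : Finset ℕ := (Finset.range (n + 1)).filter fun l : ℕ => l ≤ K ∧ ν₁ * k < l with hT2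
  set A1 : Set ((Fin m → ℝ) × (Fin m → ℝ)) :=
    ⋃ t ∈ T1, ⋃ P ∈ prs n K t.2.2, Ev ord t.1 t.2.1 P with hA1
  set A2 : Set ((Fin m → ℝ) × (Fin m → ℝ)) :=
    ⋃ l ∈ T2, ⋃ P ∈ prs n K l, Ev ord 0 m P with hA2
  have hmn : m + 1 ≤ (n + 1) ^ 2 := by
    have h1 : n * (n - 1) / 2 ≤ n * n :=
      (Nat.div_le_self _ _).trans (Nat.mul_le_mul_left _ (Nat.sub_le _ _))
    nlinarith
  have hc1 : T1.card ≤ (n + 1) ^ 5 := by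
    rw [hT1, Finset.card_product, Finset.card_product, Finset.card_range]
    have : ((Finset.range (n + 1)).filter
        fun l : ℕ => l ≤ K ∧ ν₁ * k < l ∧ (l : ℝ) < ν₂ * k).card ≤ n + 1 :=
      (Finset.card_filter_le _ _).trans (by simp)
    calc _ ≤ (n + 1) ^ 2 * ((n + 1) ^ 2 * (n + 1)) :=
          Nat.mul_le_mul hmn (Nat.mul_le_mul hmn this)
      _ = _ := by ring
  have hc2 : T2.card ≤ (n + 1) ^ 5 := by
    refine ((Finset.card_filter_le _ _).trans (by simp)).trans
      (Nat.le_self_pow (by norm_num : 5 ≠ 0) (n + 1))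
  have hA1b : μ A1 ≤ ENNReal.ofReal (((n : ℝ) + 1) ^ 5 * Real.exp B) := by
    refine (measure_biUnion_finset_le _ _).trans ((Finset.sum_le_card_nsmul _ _
      (ENNReal.ofReal (Real.exp B)) ?_).trans ?_)
    · rintro ⟨i, j, l⟩ ht
      simp only [hT1, Finset.mem_product, Finset.mem_filter] at ht
      obtain ⟨_, _, _, hlK, hl1, hl2⟩ := ht
      refine fam_bd ord i j K l μ _ (-p * ((K : ℝ) ^ 2 - K - ((l : ℝ) ^ 2 - l) / 2)) _ (prs_bd n K l hlK d hLg1 hd0)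
        (fun P hP => ?_) ?_
      · simp only [prs, Finset.mem_filter, Finset.mem_univ, true_and] at hP
        exact Ev_bound ord i j P p hp0 hp1 K l hP.1 hP.2.1 hP.2.2
      · have := exponent α d n K l δ k (Real.log d) p L hd0 hn0 hα0 (by linarith) hLgδ hL hk hp
          hK hK1 hK2 (Nat.cast_nonneg l) (1 / 2) (by norm_num) (by
            have := hG1 (l / k) ((le_div_iff₀ hk0).2 hl1.le) ((div_le_iff₀ hk0).2 hl2.le)
            refine le_trans (le_of_eq ?_) this
            ring)
        rw [← hL]
        refine le_trans (le_of_eq ?_) this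
        ring
    · rw [nsmul_eq_mul, ← ENNReal.ofReal_natCast, ← ENNReal.ofReal_mul (by positivity)]
      apply ENNReal.ofReal_le_ofReal
      apply mul_le_mul_of_nonneg_right _ (Real.exp_pos _).le
      exact_mod_cast hc1
  have hA2b : μ A2 ≤ ENNReal.ofReal (((n : ℝ) + 1) ^ 5 * Real.exp B) := by
    refine (measure_biUnion_finset_le _ _).trans ((Finset.sum_le_card_nsmul _ _
      (ENNReal.ofReal (Real.exp B)) ?_).trans ?_)
    · intro l ht
      simp only [hT2, Finset.mem_filter] at ht
      obtain ⟨_, hlK, hl1⟩ := ht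
      refine fam_bd ord 0 m K l μ _ (-p * ((K : ℝ) ^ 2 - K)) _ (prs_bd n K l hlK d hLg1 hd0)
        (fun P hP => ?_) ?_
      · simp only [prs, Finset.mem_filter, Finset.mem_univ, true_and] at hP
        exact Ev_bound_sep ord P p hp0 hp1 K hP.1 hP.2.1
      · have := exponent α d n K l δ k (Real.log d) p L hd0 hn0 hα0 (by linarith) hLgδ hL hk hp
          hK hK1 hK2 (Nat.cast_nonneg l) 0 le_rfl (by
            have := hG2 (l / k) ((le_div_iff₀ hk0).2 hl1.le)
            refine le_trans (le_of_eq ?_) this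
            ring)
        rw [← hL]
        refine le_trans (le_of_eq ?_) this
        ring
    · rw [nsmul_eq_mul, ← ENNReal.ofReal_natCast, ← ENNReal.ofReal_mul (by positivity)]
      apply ENNReal.ofReal_le_ofReal
      apply mul_le_mul_of_nonneg_right _ (Real.exp_pos _).le
      exact_mod_cast hc2
  set G : Set ((Fin m → ℝ) × (Fin m → ℝ)) := {YY' | HasOGP (misFamily ord YY'.1 YY'.2) (boolCube n)
    (olap n) k (ν₁ * (k / n)) (ν₂ * (k / n)) ∧ SeparatedAbove (Fmis ord YY'.1) (Fmis ord YY'.2)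
    (boolCube n) (olap n) k (ν₁ * (k / n))} with hGd
  have hcov : Set.univ ⊆ G ∪ (A1 ∪ A2) := by
    intro Z _
    by_cases hZ : Z ∈ A1 ∪ A2
    · exact Or.inr hZ
    left
    have hZ1 : Z ∉ A1 := fun h => hZ (Or.inl h)
    have hZ2 : Z ∉ A2 := fun h => hZ (Or.inr h)
    have hcard : ∀ x y : Fin n → ℝ, (sf x ∩ sf y).card ≤ n := fun x y =>
      (Finset.card_le_univ _).trans (by simp)
    constructor
    · rintro f₁ ⟨i, hi, rfl⟩ f₂ ⟨j, hj, rfl⟩ x hx y hy h1 h2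
      rw [olap_eq x y hx hy]
      by_contra hcon
      simp only [Set.mem_union, Set.mem_Icc, not_or, not_and, not_le] at hcon
      have g1 := hcon.1 (by positivity)
      have g2 : ((sf x ∩ sf y).card : ℝ) / n < ν₂ * (k / n) := by
        by_contra hge
        have h := hcon.2 (not_lt.1 hge)
        have h' : ((sf x ∩ sf y).card : ℝ) / n ≤ 1 :=
          (div_le_one hn0).2 (by exact_mod_cast hcard x y)
        linarith
      rw [← mul_div_assoc, div_lt_div_iff_of_pos_right hn0] at g1 g2
      have hlK : (sf x ∩ sf y).card ≤ K := by
        have : ((sf x ∩ sf y).card : ℝ) ≤ K := by nlinarith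
        exact_mod_cast this
      obtain ⟨P, hP, hE⟩ := to_Ev ord i j Z x y k hk0 h1 h2
      rw [min_eq_right hlK] at hP
      apply hZ1
      simp only [hA1, Set.mem_iUnion]
      refine ⟨(i, j, (sf x ∩ sf y).card), ?_, P, hP, hE⟩
      simp only [hT1, Finset.mem_product, Finset.mem_filter, Finset.mem_range]
      exact ⟨by omega, by omega, by have := hcard x y; omega, hlK, g1, g2⟩
    · intro x hx y hy h1 h2
      rw [olap_eq x y hx hy]
      by_contra hcon
      have g1 := not_le.1 hcon
      rw [← mul_div_assoc, div_lt_div_iff_of_pos_right hn0] at g1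
      have e1 : pathVec m Z.1 Z.2 0 = Z.1 := by funext q; simp [pathVec]
      have e2 : pathVec m Z.1 Z.2 m = Z.2 := by funext q; simp [pathVec]
      obtain ⟨P, hP, hE⟩ := to_Ev ord 0 m Z x y k hk0 (by rwa [e1]) (by rwa [e2])
      apply hZ2
      simp only [hA2, Set.mem_iUnion]
      refine ⟨_, ?_, P, hP, hE⟩
      simp only [hT2, Finset.mem_filter, Finset.mem_range]
      refine ⟨by have := hcard x y; omega, min_le_left _ _, ?_⟩
      rw [Nat.cast_min]
      exact lt_min (by nlinarith) g1
  have hpr : (1 : ENNReal) = μ Set.univ := by rw [hμ, measure_univ]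
  have hA : μ (A1 ∪ A2) ≤ ENNReal.ofReal (Real.exp (-L * n)) := by
    refine (measure_union_le _ _).trans ((add_le_add hA1b hA2b).trans ?_)
    rw [← ENNReal.ofReal_add (by positivity) (by positivity)]
    apply ENNReal.ofReal_le_ofReal
    have := hN n hnN
    linarith
  have h1 : (1 : ENNReal) ≤ μ G + ENNReal.ofReal (Real.exp (-L * n)) := by
    rw [hpr]
    exact (measure_mono hcov).trans ((measure_union_le _ _).trans (add_le_add le_rfl hA))
  rw [ENNReal.ofReal_sub _ (Real.exp_pos _).le, ENNReal.ofReal_one]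
  exact tsub_le_iff_right.2 h1
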